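/- arXiv:1312.7580 — 4 statements merged into one kernel-verified Lean document; each statement's English description precedes it below -/
import Mathlib

section
/- Suppose 0 < γ_c < 1 and λ_L − (1/2)μ‖p‖₁²λ_U² > 0, and suppose the blocks z_1,…,z_N ∈ ℝ^M satisfy ‖z_k‖⁴ ≤ λ_U⁴‖B‖_∞⁴ Σ_{l=1}^{N−1}‖w_{e,l}‖⁴ for every k. Then for all x, y ∈ ℝ^M: ‖T_c(x) − T_c(y) − μ·Σ_{k=1}^N p_k z_k‖⁴ ≤ γ_c·‖x − y‖⁴ + [μ·‖p‖₁⁴·λ_U⁴·‖B‖_∞⁴ / (λ_L − (1/2)μ‖p‖₁²λ_U²)³]·Σ_{l=1}^{N−1}‖w_{e,l}‖⁴. -/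
open scoped RealInnerProductSpace

noncomputable section

/-- Maximum absolute row sum of a matrix (the `‖·‖_∞` induced norm). -/
def maxRowSum {n m : ℕ} (B : Matrix (Fin n) (Fin m) ℝ) : ℝ := ⨆ k, ∑ l, |B k l|

/-- A step along a `lam`-strongly monotone increment `g` of `v` with `‖g‖ ≤ L * ‖v‖` contracts. -/
theorem norm_sub_smul_le_of_strongly_monotone {E : Type*} [NormedAddCommGroup E]
    [InnerProductSpace ℝ E] {v g : E} {lam L μ : ℝ} (hμ : 0 ≤ μ)
    (hg : ‖g‖ ≤ L * ‖v‖) (hmono : lam * ‖v‖ ^ 2 ≤ ⟪v, g⟫)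
    (hγ : 0 ≤ 1 - μ * (lam - (1 / 2) * μ * L ^ 2)) :
    ‖v - μ • g‖ ≤ (1 - μ * (lam - (1 / 2) * μ * L ^ 2)) * ‖v‖ := by
  have hsq : ‖g‖ ^ 2 ≤ L ^ 2 * ‖v‖ ^ 2 := by
    rw [← mul_pow]
    exact pow_le_pow_left₀ (norm_nonneg g) hg 2
  refine le_of_sq_le_sq ?_ (mul_nonneg hγ (norm_nonneg v))
  rw [norm_sub_sq_real, inner_smul_right, norm_smul, mul_pow, mul_pow, Real.norm_eq_abs, sq_abs]
  have h₁ := mul_le_mul_of_nonneg_left hmono hμ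
  have h₂ := mul_le_mul_of_nonneg_left hsq (sq_nonneg μ)
  nlinarith [sq_nonneg (μ * (lam - (1 / 2) * μ * L ^ 2) * ‖v‖)]

/-- Weighted triangle inequality with a uniform bound on the terms. -/
theorem norm_sum_smul_le_sum_mul {ι E : Type*} [Fintype ι] [NormedAddCommGroup E]
    [NormedSpace ℝ E] {p : ι → ℝ} (hp : ∀ k, 0 ≤ p k) {f : ι → E} {C : ℝ}
    (hf : ∀ k, ‖f k‖ ≤ C) : ‖∑ k, p k • f k‖ ≤ (∑ k, p k) * C := by
  rw [Finset.sum_mul]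
  refine norm_sum_le_of_le _ fun k _ => ?_
  rw [norm_smul, Real.norm_of_nonneg (hp k)]
  exact mul_le_mul_of_nonneg_left (hf k) (hp k)

/-- Fourth-power contraction bound for the centralized operator
`T_c(w) = w - μ ∑ₖ p_k s_k(w)` perturbed by the blocks `z_k`. -/
theorem Tc_z_fourth_bound
    (N M : ℕ)
    (s : Fin N → EuclideanSpace ℝ (Fin M) → EuclideanSpace ℝ (Fin M))
    (lamU lamL μ : ℝ) (hlamL : 0 < lamL) (hμ : 0 < μ)
    (p : Fin N → ℝ) (hp : ∀ k, 0 < p k)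
    (hLip : ∀ k x y, ‖s k x - s k y‖ ≤ lamU * ‖x - y‖)
    (hmono : ∀ x y : EuclideanSpace ℝ (Fin M),
      lamL * ‖x - y‖ ^ 2 ≤ ⟪x - y, ∑ k, p k • (s k x - s k y)⟫)
    (hγ0 : 0 < 1 - μ * lamL + (1 / 2) * μ ^ 2 * (∑ k, p k) ^ 2 * lamU ^ 2)
    (hγ1 : 1 - μ * lamL + (1 / 2) * μ ^ 2 * (∑ k, p k) ^ 2 * lamU ^ 2 < 1)
    (hden : 0 < lamL - (1 / 2) * μ * (∑ k, p k) ^ 2 * lamU ^ 2)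
    (B : Matrix (Fin N) (Fin (N - 1)) ℝ)
    (we : Fin (N - 1) → EuclideanSpace ℝ (Fin M))
    (z : Fin N → EuclideanSpace ℝ (Fin M))
    (hz : ∀ k, ‖z k‖ ^ 4 ≤ lamU ^ 4 * maxRowSum B ^ 4 * ∑ l, ‖we l‖ ^ 4) :
    ∀ x y : EuclideanSpace ℝ (Fin M),
      ‖(x - μ • ∑ k, p k • s k x) - (y - μ • ∑ k, p k • s k y) - μ • ∑ k, p k • z k‖ ^ 4
        ≤ (1 - μ * lamL + (1 / 2) * μ ^ 2 * (∑ k, p k) ^ 2 * lamU ^ 2) * ‖x - y‖ ^ 4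
          + μ * (∑ k, p k) ^ 4 * lamU ^ 4 * maxRowSum B ^ 4
              / (lamL - (1 / 2) * μ * (∑ k, p k) ^ 2 * lamU ^ 2) ^ 3
            * ∑ l, ‖we l‖ ^ 4 := by
  intro x y
  set P := ∑ k, p k
  set d := lamL - (1 / 2) * μ * P ^ 2 * lamU ^ 2 with hd
  set C := lamU ^ 4 * maxRowSum B ^ 4 * ∑ l, ‖we l‖ ^ 4 with hC
  have hγ : 1 - μ * lamL + (1 / 2) * μ ^ 2 * P ^ 2 * lamU ^ 2 = 1 - μ * d := by
    rw [hd]; ring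
  have hd' : d = lamL - (1 / 2) * μ * (P * lamU) ^ 2 := by
    rw [hd]; ring
  rw [hγ] at hγ0 ⊢
  have hC0 : 0 ≤ C := by positivity
  have hP : 0 ≤ P := Finset.sum_nonneg fun k _ => (hp k).le
  obtain ⟨Z, hZ0, hZ⟩ : ∃ Z : ℝ, 0 ≤ Z ∧ Z ^ 4 = C :=
    ⟨√√C, Real.sqrt_nonneg _, by
      rw [show 4 = 2 * 2 from rfl, pow_mul, Real.sq_sqrt (Real.sqrt_nonneg _), Real.sq_sqrt hC0]⟩
  have hzZ : ‖∑ k, p k • z k‖ ≤ P * Z :=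
    norm_sum_smul_le_sum_mul (fun k => (hp k).le) fun k =>
      le_of_pow_le_pow_left₀ four_ne_zero hZ0 ((hz k).trans_eq hZ.symm)
  have hg : ‖∑ k, p k • (s k x - s k y)‖ ≤ P * lamU * ‖x - y‖ := by
    rw [mul_assoc]
    exact norm_sum_smul_le_sum_mul (fun k => (hp k).le) fun k => hLip k x y
  have hcontr : ‖(x - y) - μ • ∑ k, p k • (s k x - s k y)‖ ≤ (1 - μ * d) * ‖x - y‖ := by
    rw [hd'] at hγ0 ⊢
    exact norm_sub_smul_le_of_strongly_monotone hμ.le hg (hmono x y) hγ0.le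
  have hsplit : (x - μ • ∑ k, p k • s k x) - (y - μ • ∑ k, p k • s k y)
      = (x - y) - μ • ∑ k, p k • (s k x - s k y) := by
    simp only [smul_sub, Finset.sum_sub_distrib]
    abel
  have hnorm : ‖(x - μ • ∑ k, p k • s k x) - (y - μ • ∑ k, p k • s k y) - μ • ∑ k, p k • z k‖
      ≤ (1 - μ * d) * ‖x - y‖ + μ * d * (P * Z / d) := by
    rw [hsplit]
    refine (norm_sub_le _ _).trans (add_le_add hcontr ?_)
    rw [norm_smul, Real.norm_of_nonneg hμ.le, mul_assoc, mul_div_cancel₀ _ hden.ne']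
    exact mul_le_mul_of_nonneg_left hzZ hμ.le
  have hconv : ((1 - μ * d) * ‖x - y‖ + μ * d * (P * Z / d)) ^ 4
      ≤ (1 - μ * d) * ‖x - y‖ ^ 4 + μ * d * (P * Z / d) ^ 4 :=
    (convexOn_pow 4).2 (norm_nonneg (x - y)) (show 0 ≤ P * Z / d by positivity)
      hγ0.le (by positivity) (by ring)
  refine (pow_le_pow_left₀ (norm_nonneg _) hnorm 4).trans (hconv.trans_eq ?_)
  rw [div_pow, mul_pow, hZ, hC]
  field_simp

end
end

section
/- Let Q be a block matrix with M×M blocks Q_{kl} (k = 1,…,K; l = 1,…,L), and let x = col{x_1,…,x_L} with x_l ∈ ℝ^M. Then for every k: ‖Σ_{l=1}^L Q_{kl} x_l‖⁴ ≤ ‖P̄[Q]‖_∞³ · Σ_{l=1}^L ‖Q_{kl}‖·‖x_l‖⁴, and consequently ‖Σ_{l=1}^L Q_{kl} x_l‖⁴ ≤ ‖P̄[Q]‖_∞⁴ · Σ_{l=1}^L ‖x_l‖⁴. Equivalently, P⁽⁴⁾[Qx] ⪯ ‖P̄[Q]‖_∞³ · P̄[Q]·P⁽⁴⁾[x] ⪯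 ‖P̄[Q]‖_∞⁴ · 11ᵀ·P⁽⁴⁾[x] entrywise. -/
noncomputable section

/-- The `2`-induced operator norm of a real matrix. -/
def matOpNorm {m n : Type*} [Fintype m] [Fintype n] [DecidableEq n] (A : Matrix m n ℝ) : ℝ :=
  ‖LinearMap.toContinuousLinearMap (Matrix.toEuclideanLin A)‖

theorem sum_mul_sq_le_sum_mul_sum_mul_sq {ι : Type*} (s : Finset ι) (w z : ι → ℝ)
    (hw : ∀ i ∈ s, 0 ≤ w i) :
    (∑ i ∈ s, w i * z i) ^ 2 ≤ (∑ i ∈ s, w i) * ∑ i ∈ s, w i * z i ^ 2 :=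
  Finset.sum_sq_le_sum_mul_sum_of_sq_le_mul s hw
    (fun i hi => mul_nonneg (hw i hi) (sq_nonneg _)) (fun i _ => by
      rw [mul_pow, ← mul_assoc, ← sq])

theorem sum_mul_pow_four_le {ι : Type*} (s : Finset ι) (w z : ι → ℝ)
    (hw : ∀ i ∈ s, 0 ≤ w i) :
    (∑ i ∈ s, w i * z i) ^ 4 ≤ (∑ i ∈ s, w i) ^ 3 * ∑ i ∈ s, w i * z i ^ 4 := by
  have h := sum_mul_sq_le_sum_mul_sum_mul_sq s w (fun i => z i ^ 2) hw
  simp only [← pow_mul, Nat.reduceMul] at h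
  calc (∑ i ∈ s, w i * z i) ^ 4 = ((∑ i ∈ s, w i * z i) ^ 2) ^ 2 := by ring
    _ ≤ ((∑ i ∈ s, w i) * ∑ i ∈ s, w i * z i ^ 2) ^ 2 := by
      gcongr
      exact sum_mul_sq_le_sum_mul_sum_mul_sq s w z hw
    _ = (∑ i ∈ s, w i) ^ 2 * (∑ i ∈ s, w i * z i ^ 2) ^ 2 := by ring
    _ ≤ (∑ i ∈ s, w i) ^ 2 * ((∑ i ∈ s, w i) * ∑ i ∈ s, w i * z i ^ 4) := by gcongr
    _ = (∑ i ∈ s, w i) ^ 3 * ∑ i ∈ s, w i * z i ^ 4 := by ring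

theorem matOpNorm_nonneg {m n : Type*} [Fintype m] [Fintype n] [DecidableEq n]
    (A : Matrix m n ℝ) : 0 ≤ matOpNorm A :=
  norm_nonneg _

theorem norm_toEuclideanLin_le {m n : Type*} [Fintype m] [Fintype n] [DecidableEq n]
    (A : Matrix m n ℝ) (v : EuclideanSpace ℝ n) :
    ‖Matrix.toEuclideanLin A v‖ ≤ matOpNorm A * ‖v‖ :=
  (LinearMap.toContinuousLinearMap (Matrix.toEuclideanLin A)).le_opNorm v

theorem sum_abs_le_maxRowSum {n m : ℕ} (B : Matrix (Fin n) (Fin m) ℝ) (k : Fin n) :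
    ∑ l, |B k l| ≤ maxRowSum B :=
  le_ciSup (f := fun k => ∑ l, |B k l|) (Set.finite_range _).bddAbove k

/-- For a block matrix `Q` with `M×M` blocks `Q k l` acting on a block
vector `x`, every block of `Q x` satisfies the fourth-power bounds
`‖(Qx)_k‖⁴ ≤ ‖P̄[Q]‖_∞³ ∑ l ‖Q_{kl}‖ ‖x_l‖⁴ ≤ ‖P̄[Q]‖_∞⁴ ∑ l ‖x_l‖⁴`,
i.e. `P⁽⁴⁾[Qx] ⪯ ‖P̄[Q]‖_∞³ P̄[Q] P⁽⁴⁾[x] ⪯ ‖P̄[Q]‖_∞⁴ 𝟙𝟙ᵀ P⁽⁴⁾[x]` entrywise. -/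
theorem block_linear_fourth_moment_bound
    (K L M : ℕ)
    (Q : Fin K → Fin L → Matrix (Fin M) (Fin M) ℝ)
    (x : Fin L → EuclideanSpace ℝ (Fin M)) :
    ∀ k : Fin K,
      ‖∑ l, Matrix.toEuclideanLin (Q k l) (x l)‖ ^ 4
          ≤ maxRowSum (Matrix.of fun (k : Fin K) (l : Fin L) => matOpNorm (Q k l)) ^ 3
              * ∑ l, matOpNorm (Q k l) * ‖x l‖ ^ 4 ∧
      ‖∑ l, Matrix.toEuclideanLin (Q k l) (x l)‖ ^ 4
          ≤ maxRowSum (Matrix.of fun (k : Fin K) (l : Fin L) => matOpNorm (Q k l)) ^ 4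
              * ∑ l, ‖x l‖ ^ 4 := by
  intro k
  set S := maxRowSum (Matrix.of fun (k : Fin K) (l : Fin L) => matOpNorm (Q k l))
  have hQ : ∀ l, 0 ≤ matOpNorm (Q k l) := fun l => matOpNorm_nonneg _
  have hrow : ∑ l, matOpNorm (Q k l) ≤ S := by
    simpa [abs_of_nonneg, hQ] using sum_abs_le_maxRowSum
      (Matrix.of fun (k : Fin K) (l : Fin L) => matOpNorm (Q k l)) k
  have hrow_nonneg : 0 ≤ ∑ l, matOpNorm (Q k l) := Finset.sum_nonneg fun l _ => hQ l
  have hS : 0 ≤ S := hrow_nonneg.trans hrow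
  have hentry : ∀ l, matOpNorm (Q k l) ≤ S := fun l =>
    (Finset.single_le_sum (fun l _ => hQ l) (Finset.mem_univ l)).trans hrow
  have hsum_nonneg : 0 ≤ ∑ l, matOpNorm (Q k l) * ‖x l‖ ^ 4 :=
    Finset.sum_nonneg fun l _ => mul_nonneg (hQ l) (by positivity)
  have hnorm : ‖∑ l, Matrix.toEuclideanLin (Q k l) (x l)‖ ≤ ∑ l, matOpNorm (Q k l) * ‖x l‖ :=
    norm_sum_le_of_le _ fun l _ => norm_toEuclideanLin_le _ _
  have hfirst : ‖∑ l, Matrix.toEuclideanLin (Q k l) (x l)‖ ^ 4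
      ≤ S ^ 3 * ∑ l, matOpNorm (Q k l) * ‖x l‖ ^ 4 :=
    calc _ ≤ (∑ l, matOpNorm (Q k l) * ‖x l‖) ^ 4 := by gcongr
      _ ≤ (∑ l, matOpNorm (Q k l)) ^ 3 * ∑ l, matOpNorm (Q k l) * ‖x l‖ ^ 4 :=
        sum_mul_pow_four_le _ _ _ fun l _ => hQ l
      _ ≤ _ := by gcongr
  refine ⟨hfirst, hfirst.trans ?_⟩
  calc S ^ 3 * ∑ l, matOpNorm (Q k l) * ‖x l‖ ^ 4
      ≤ S ^ 3 * ∑ l, S * ‖x l‖ ^ 4 := by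
        gcongr with l
        exact hentry l
    _ = S ^ 4 * ∑ l, ‖x l‖ ^ 4 := by rw [← Finset.mul_sum]; ring

end
end

section
/- Let d ∈ ℝ with |d| < 1 and a, b, c ∈ ℝ^M. Then ‖d·a + b‖⁴ ≤ |d|·‖a‖⁴ + (1−|d|)^{−3}·‖b‖⁴ and ‖d·a + b + c‖⁴ ≤ |d|·‖a‖⁴ + 8·(1−|d|)^{−3}·(‖b‖⁴ + ‖c‖⁴). Consequently, if D_L is an L×L matrix whose diagonal entries all have modulus at most |d₂| < 1, whose superdiagonal entries are 0 or 1, and whose other entries are zero, and 𝒟_L := D_L ⊗ I_M, then for all block vectors x_e, y_e ∈ ℝ^{LM}: P⁽⁴⁾[𝒟_L x_e + y_e] ⪯ Γ_{e,4}·P⁽⁴⁾[x_e] + 8·(1−|d₂|)^{−3}·P⁽⁴⁾[y_e] entrywise, where Γ_{e,4} is the L×L matrix with |d₂| on its diagonal, 8/(1−|d₂|)³ on its superdiagonal, and zeros elsewhere. -/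
/-- Jensen's inequality for `x ↦ x ^ 4`, applied to a perturbed contraction. -/
theorem norm_smul_add_pow_four_le {E : Type*} [NormedAddCommGroup E] [NormedSpace ℝ E]
    {d s : ℝ} (hd : |d| ≤ s) (hs : s < 1) (a b : E) :
    ‖d • a + b‖ ^ 4 ≤ s * ‖a‖ ^ 4 + ((1 - s) ^ 3)⁻¹ * ‖b‖ ^ 4 := by
  have hs0 : 0 ≤ s := (abs_nonneg d).trans hd
  have ht : 0 < 1 - s := sub_pos.mpr hs
  have hnorm : ‖d • a + b‖ ≤ s * ‖a‖ + (1 - s) * (‖b‖ / (1 - s)) := by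
    rw [mul_div_cancel₀ _ ht.ne']
    refine (norm_add_le _ _).trans ?_
    rw [norm_smul, Real.norm_eq_abs]
    gcongr
  calc ‖d • a + b‖ ^ 4
      ≤ (s * ‖a‖ + (1 - s) * (‖b‖ / (1 - s))) ^ 4 := by gcongr
    _ ≤ s * ‖a‖ ^ 4 + (1 - s) * (‖b‖ / (1 - s)) ^ 4 := by
        have h := (convexOn_pow (𝕜 := ℝ) 4).2 (Set.mem_Ici.mpr (norm_nonneg a))
          (Set.mem_Ici.mpr (div_nonneg (norm_nonneg b) ht.le)) hs0 ht.le (by ring)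
        simpa only [smul_eq_mul] using h
    _ = s * ‖a‖ ^ 4 + ((1 - s) ^ 3)⁻¹ * ‖b‖ ^ 4 := by
        have := ht.ne'
        field_simp

theorem norm_add_pow_four_le {E : Type*} [SeminormedAddGroup E] (b c : E) :
    ‖b + c‖ ^ 4 ≤ 8 * (‖b‖ ^ 4 + ‖c‖ ^ 4) := by
  calc ‖b + c‖ ^ 4 ≤ (‖b‖ + ‖c‖) ^ 4 := by gcongr; exact norm_add_le b c
    _ ≤ 2 ^ (4 - 1) * (‖b‖ ^ 4 + ‖c‖ ^ 4) := add_pow_le (norm_nonneg b) (norm_nonneg c) 4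
    _ = 8 * (‖b‖ ^ 4 + ‖c‖ ^ 4) := by norm_num

theorem norm_smul_add_add_pow_four_le {E : Type*} [NormedAddCommGroup E] [NormedSpace ℝ E]
    {d s : ℝ} (hd : |d| ≤ s) (hs : s < 1) (a b c : E) :
    ‖d • a + b + c‖ ^ 4
      ≤ s * ‖a‖ ^ 4 + 8 * ((1 - s) ^ 3)⁻¹ * (‖b‖ ^ 4 + ‖c‖ ^ 4) := by
  have ht : 0 < 1 - s := sub_pos.mpr hs
  calc ‖d • a + b + c‖ ^ 4 = ‖d • a + (b + c)‖ ^ 4 := by rw [add_assoc]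
    _ ≤ s * ‖a‖ ^ 4 + ((1 - s) ^ 3)⁻¹ * ‖b + c‖ ^ 4 := norm_smul_add_pow_four_le hd hs a _
    _ ≤ s * ‖a‖ ^ 4 + ((1 - s) ^ 3)⁻¹ * (8 * (‖b‖ ^ 4 + ‖c‖ ^ 4)) := by
        gcongr
        exact norm_add_pow_four_le b c
    _ = s * ‖a‖ ^ 4 + 8 * ((1 - s) ^ 3)⁻¹ * (‖b‖ ^ 4 + ‖c‖ ^ 4) := by ring

/-- Fourth-power inequalities used for stable Jordan blocks:
scalar versions for `|d| < 1`, and the block version for a Jordan-form matrix `D_L`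
(diagonal of modulus at most `|d₂| < 1`, superdiagonal entries `0` or `1`). -/
theorem jordan_fourth_moment_bound
    (M L : ℕ) (d d2 : ℝ) (hd : |d| < 1) (hd2 : |d2| < 1)
    (D : Matrix (Fin L) (Fin L) ℝ)
    (hDdiag : ∀ i, |D i i| ≤ |d2|)
    (hDsuper : ∀ i j : Fin L, (j : ℕ) = (i : ℕ) + 1 → D i j = 0 ∨ D i j = 1)
    (hDzero : ∀ i j : Fin L, (j : ℕ) ≠ (i : ℕ) → (j : ℕ) ≠ (i : ℕ) + 1 → D i j = 0) :
    (∀ a b : EuclideanSpace ℝ (Fin M),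
        ‖d • a + b‖ ^ 4 ≤ |d| * ‖a‖ ^ 4 + ((1 - |d|) ^ 3)⁻¹ * ‖b‖ ^ 4) ∧
    (∀ a b c : EuclideanSpace ℝ (Fin M),
        ‖d • a + b + c‖ ^ 4
          ≤ |d| * ‖a‖ ^ 4 + 8 * ((1 - |d|) ^ 3)⁻¹ * (‖b‖ ^ 4 + ‖c‖ ^ 4)) ∧
    (∀ (xe ye : Fin L → EuclideanSpace ℝ (Fin M)) (k : Fin L),
        ‖(∑ j, D k j • xe j) + ye k‖ ^ 4
          ≤ (∑ j, (if j = k then |d2|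
                else if (j : ℕ) = (k : ℕ) + 1 then 8 / (1 - |d2|) ^ 3 else 0) * ‖xe j‖ ^ 4)
            + 8 / (1 - |d2|) ^ 3 * ‖ye k‖ ^ 4) := by
  refine ⟨norm_smul_add_pow_four_le le_rfl hd, norm_smul_add_add_pow_four_le le_rfl hd, ?_⟩
  intro xe ye k
  rw [← Finset.add_sum_erase _ _ (Finset.mem_univ k),
    ← Finset.add_sum_erase _ (fun j => _ * ‖xe j‖ ^ 4) (Finset.mem_univ k), if_pos rfl]
  refine (norm_smul_add_add_pow_four_le (hDdiag k) hd2 _ _ _).trans ?_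
  have ht : 0 < 1 - |d2| := sub_pos.mpr hd2
  have hoff : 8 / (1 - |d2|) ^ 3 * ‖∑ j ∈ Finset.univ.erase k, D k j • xe j‖ ^ 4
      ≤ ∑ j ∈ Finset.univ.erase k, (if j = k then |d2|
          else if (j : ℕ) = (k : ℕ) + 1 then 8 / (1 - |d2|) ^ 3 else 0) * ‖xe j‖ ^ 4 := by
    by_cases hk : (k : ℕ) + 1 < L
    · let m : Fin L := ⟨(k : ℕ) + 1, hk⟩
      have hmk : m ≠ k := fun h => by simpa [m] using congrArg Fin.val h
      have hmem : m ∈ Finset.univ.erase k := by simp [hmk]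
      rw [Finset.sum_eq_single_of_mem m hmem, Finset.sum_eq_single_of_mem m hmem,
        if_neg hmk, if_pos rfl]
      · gcongr
        rcases hDsuper k m rfl with h | h <;> simp [h]
      · intro j hj hjm
        rw [if_neg (Finset.ne_of_mem_erase hj), if_neg (fun h => hjm (Fin.ext h)), zero_mul]
      · intro j hj hjm
        rw [hDzero k j (fun h => Finset.ne_of_mem_erase hj (Fin.ext h))
          (fun h => hjm (Fin.ext h)), zero_smul]
    · rw [Finset.sum_eq_zero (f := fun j => D k j • xe j)]
      · rw [norm_zero, zero_pow four_ne_zero, mul_zero]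
        refine Finset.sum_nonneg fun j _ => ?_
        split_ifs <;> positivity
      · intro j hj
        rw [hDzero k j (fun h => Finset.ne_of_mem_erase hj (Fin.ext h)) (by omega), zero_smul]
  rw [← div_eq_mul_inv, mul_add]
  linarith
end

section
/- Let N ≥ 1, let each node k ∈ {1,…,N} have a neighborhood N_k ⊆ {1,…,N} with k ∈ N_k and with the symmetry ℓ ∈ N_k ⇔ k ∈ N_ℓ, and let p ∈ ℝ^N have all entries p_k > 0. Define a_{ℓk} := p_k^{−1} / max{|N_k|·p_k^{−1}, |N_ℓ|·p_ℓ^{−1}} for ℓ ∈ N_k \ {k}, a_{ℓk} := 0 for ℓ ∉ N_k, and a_{kk} := 1 − Σ_{m ∈ N_k \ {k}} a_{mk}. Then the matrix A = (a_{ℓk}): (i) has all entries nonnegative, with a_{ℓk} > 0 whenever ℓ ∈ N_k (in particular a_{kk} ≥ 1/|N_k| > 0) and a_{ℓk} = 0 whenever ℓ ∉ N_k; (ii) is left-stochastic, i.e., Σ_{ℓ=1}^N a_{ℓk} = 1 for every k; and (iii) has p as a right-eigenvector with eigenvalue one: Ap = p. -/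
noncomputable section

/-- Off-diagonal entries of the Hastings combination rule. -/
def hastOff {N : ℕ} (Nbr : Fin N → Finset (Fin N)) (p : Fin N → ℝ) (ℓ k : Fin N) : ℝ :=
  (p k)⁻¹ / max (((Nbr k).card : ℝ) * (p k)⁻¹) (((Nbr ℓ).card : ℝ) * (p ℓ)⁻¹)

/-- The Hastings combination matrix `A = (a_{ℓk})`. -/
def hastMat {N : ℕ} (Nbr : Fin N → Finset (Fin N)) (p : Fin N → ℝ) :
    Matrix (Fin N) (Fin N) ℝ :=
  Matrix.of fun ℓ k =>
    if ℓ = k then 1 - ∑ m ∈ (Nbr k).erase k, hastOff Nbr p m k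
    else if ℓ ∈ Nbr k then hastOff Nbr p ℓ k
    else 0

lemma hastOff_pos {N : ℕ} {Nbr : Fin N → Finset (Fin N)} {p : Fin N → ℝ}
    (hself : ∀ k, k ∈ Nbr k) (hp : ∀ k, 0 < p k) (ℓ k : Fin N) : 0 < hastOff Nbr p ℓ k := by
  have hcard : (0 : ℝ) < (Nbr k).card := by exact_mod_cast Finset.card_pos.mpr ⟨k, hself k⟩
  have hpk := inv_pos.mpr (hp k)
  exact div_pos hpk (lt_max_of_lt_left (mul_pos hcard hpk))

lemma hastOff_le {N : ℕ} {Nbr : Fin N → Finset (Fin N)} {p : Fin N → ℝ}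
    (hself : ∀ k, k ∈ Nbr k) (hp : ∀ k, 0 < p k) (ℓ k : Fin N) :
    hastOff Nbr p ℓ k ≤ 1 / ((Nbr k).card : ℝ) := by
  have hcard : (0 : ℝ) < (Nbr k).card := by exact_mod_cast Finset.card_pos.mpr ⟨k, hself k⟩
  have hpk := inv_pos.mpr (hp k)
  calc hastOff Nbr p ℓ k ≤ (p k)⁻¹ / ((Nbr k).card * (p k)⁻¹) :=
        div_le_div_of_nonneg_left hpk.le (mul_pos hcard hpk) (le_max_left _ _)
    _ = 1 / ((Nbr k).card : ℝ) := by rw [mul_comm, div_mul_cancel_left₀ hpk.ne', one_div]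

/-- Detailed balance for the off-diagonal entries. -/
lemma hastOff_mul_comm {N : ℕ} {Nbr : Fin N → Finset (Fin N)} {p : Fin N → ℝ}
    (hp : ∀ k, 0 < p k) (ℓ k : Fin N) :
    hastOff Nbr p ℓ k * p k = hastOff Nbr p k ℓ * p ℓ := by
  unfold hastOff
  rw [max_comm, div_mul_eq_mul_div, div_mul_eq_mul_div, inv_mul_cancel₀ (hp k).ne',
    inv_mul_cancel₀ (hp ℓ).ne']

/-- Detailed balance for the Hastings matrix. -/
lemma hastMat_mul_comm {N : ℕ} {Nbr : Fin N → Finset (Fin N)} {p : Fin N → ℝ}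
    (hsym : ∀ ℓ k, ℓ ∈ Nbr k ↔ k ∈ Nbr ℓ) (hp : ∀ k, 0 < p k) (ℓ k : Fin N) :
    hastMat Nbr p ℓ k * p k = hastMat Nbr p k ℓ * p ℓ := by
  rcases eq_or_ne ℓ k with rfl | h
  · rfl
  · simp only [hastMat, Matrix.of_apply, if_neg h, if_neg h.symm, hsym ℓ k]
    split_ifs
    · exact hastOff_mul_comm hp ℓ k
    · simp

lemma one_div_card_le_hastMat_self {N : ℕ} {Nbr : Fin N → Finset (Fin N)} {p : Fin N → ℝ}
    (hself : ∀ k, k ∈ Nbr k) (hp : ∀ k, 0 < p k) (k : Fin N) :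
    1 / ((Nbr k).card : ℝ) ≤ hastMat Nbr p k k := by
  have hcard : (0 : ℝ) < (Nbr k).card := by exact_mod_cast Finset.card_pos.mpr ⟨k, hself k⟩
  have hsum : ∑ m ∈ Nbr k, 1 / ((Nbr k).card : ℝ) = 1 := by
    rw [Finset.sum_const, nsmul_eq_mul, mul_one_div_cancel hcard.ne']
  rw [← Finset.add_sum_erase _ _ (hself k)] at hsum
  have hle : ∑ m ∈ (Nbr k).erase k, hastOff Nbr p m k ≤
      ∑ m ∈ (Nbr k).erase k, 1 / ((Nbr k).card : ℝ) :=
    Finset.sum_le_sum fun m _ => hastOff_le hself hp m k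
  simp only [hastMat, Matrix.of_apply, if_true]
  linarith

lemma hastMat_eq_zero {N : ℕ} {Nbr : Fin N → Finset (Fin N)} (p : Fin N → ℝ)
    (hself : ∀ k, k ∈ Nbr k) {ℓ k : Fin N} (h : ℓ ∉ Nbr k) : hastMat Nbr p ℓ k = 0 := by
  have hne : ℓ ≠ k := by
    rintro rfl
    exact h (hself ℓ)
  simp [hastMat, hne, h]

lemma sum_hastMat {N : ℕ} {Nbr : Fin N → Finset (Fin N)} (p : Fin N → ℝ)
    (hself : ∀ k, k ∈ Nbr k) (k : Fin N) : ∑ ℓ, hastMat Nbr p ℓ k = 1 := by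
  rw [← Finset.sum_subset (Finset.subset_univ (Nbr k)) fun ℓ _ h => hastMat_eq_zero p hself h,
    ← Finset.add_sum_erase _ _ (hself k)]
  have hoff : ∑ ℓ ∈ (Nbr k).erase k, hastMat Nbr p ℓ k =
      ∑ ℓ ∈ (Nbr k).erase k, hastOff Nbr p ℓ k := by
    refine Finset.sum_congr rfl fun ℓ hℓ => ?_
    obtain ⟨hne, hmem⟩ := Finset.mem_erase.mp hℓ
    simp [hastMat, hne, hmem]
  rw [hoff]
  simp [hastMat]

/-- The Hastings rule produces a left-stochastic combination matrix,
supported on the neighborhoods (with strictly positive entries there, and diagonal entries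
at least `1/|N_k| > 0`), having the prescribed positive vector `p` as a right-eigenvector
with eigenvalue one. -/
theorem hastings_rule
    (N : ℕ) (hN : 1 ≤ N)
    (Nbr : Fin N → Finset (Fin N))
    (hself : ∀ k, k ∈ Nbr k)
    (hsym : ∀ ℓ k, ℓ ∈ Nbr k ↔ k ∈ Nbr ℓ)
    (p : Fin N → ℝ) (hp : ∀ k, 0 < p k) :
    (∀ ℓ k, 0 ≤ hastMat Nbr p ℓ k) ∧
    (∀ ℓ k, ℓ ∈ Nbr k → 0 < hastMat Nbr p ℓ k) ∧
    (∀ k, 1 / ((Nbr k).card : ℝ) ≤ hastMat Nbr p k k) ∧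
    (∀ k, 0 < 1 / ((Nbr k).card : ℝ)) ∧
    (∀ ℓ k, ℓ ∉ Nbr k → hastMat Nbr p ℓ k = 0) ∧
    (∀ k, ∑ ℓ, hastMat Nbr p ℓ k = 1) ∧
    (hastMat Nbr p).mulVec p = p := by
  have hcard : ∀ k, (0 : ℝ) < 1 / ((Nbr k).card : ℝ) := fun k =>
    one_div_pos.mpr (by exact_mod_cast Finset.card_pos.mpr ⟨k, hself k⟩)
  have hdiag := one_div_card_le_hastMat_self hself hp
  have hpos : ∀ ℓ k, ℓ ∈ Nbr k → 0 < hastMat Nbr p ℓ k := by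
    intro ℓ k hmem
    rcases eq_or_ne ℓ k with rfl | hne
    · exact (hcard ℓ).trans_le (hdiag ℓ)
    · simpa [hastMat, hne, hmem] using hastOff_pos hself hp ℓ k
  refine ⟨fun ℓ k => ?_, hpos, hdiag, hcard, fun ℓ k => hastMat_eq_zero p hself,
    sum_hastMat p hself, ?_⟩
  · by_cases h : ℓ ∈ Nbr k
    · exact (hpos ℓ k h).le
    · exact (hastMat_eq_zero p hself h).ge
  · ext ℓ
    simp only [Matrix.mulVec, dotProduct]
    simp_rw [hastMat_mul_comm hsym hp ℓ]
    rw [← Finset.sum_mul, sum_hastMat p hself, one_mul]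

end
end
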